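/- Suppose W is finite with longest element w_S, let I, J ⊆ S, and let p = W_I·w_S·W_J with minimal element p̲. Then the subgroup W_I ∩ p̲·W_J·p̲⁻¹ is conjugate by an element of W_I to the standard parabolic subgroup W_{I ∩ w_S·J·w_S}; in particular, |I ∩ p̲·J·p̲⁻¹| = |I ∩ w_S·J·w_S|, where p̲·J·p̲⁻¹ = {p̲·u·p̲⁻¹ : u ∈ J}. -/

import Mathlib

namespace CoxeterAtoms

variable {B : Type*} {W : Type*} [Group W] {M : CoxeterMatrix B}

/-- The standard parabolic subgroup `W_K` generated by the simple reflections indexed by `K`. -/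
def par (cs : CoxeterSystem M W) (K : Set B) : Subgroup W :=
  Subgroup.closure (cs.simple '' K)

/-- `K` is finitary if `W_K` is finite. -/
def Finitary (cs : CoxeterSystem M W) (K : Set B) : Prop :=
  ((par cs K : Set W)).Finite

/-- The left coset `W_I · x`. -/
def lcos (cs : CoxeterSystem M W) (I : Set B) (x : W) : Set W :=
  {w | ∃ a ∈ par cs I, w = a * x}

/-- The right coset `x · W_J`. -/
def rcos (cs : CoxeterSystem M W) (x : W) (J : Set B) : Set W :=
  {w | ∃ b ∈ par cs J, w = x * b}

/-- The double coset `W_I · x · W_J`. -/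
def dcos (cs : CoxeterSystem M W) (I : Set B) (x : W) (J : Set B) : Set W :=
  {w | ∃ a ∈ par cs I, ∃ b ∈ par cs J, w = a * x * b}

/-- `x` is a minimal length element of its double coset `W_I · x · W_J`. -/
def IsMinRep (cs : CoxeterSystem M W) (I : Set B) (x : W) (J : Set B) : Prop :=
  ∀ w ∈ dcos cs I x J, cs.length x ≤ cs.length w

/-- `y` is a maximal length element of the set `p`. -/
def IsMaxOf (cs : CoxeterSystem M W) (p : Set W) (y : W) : Prop :=
  y ∈ p ∧ ∀ w ∈ p, cs.length w ≤ cs.length y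

/-- `y` is the longest element of the standard parabolic subgroup `W_K`. -/
def IsLongest (cs : CoxeterSystem M W) (K : Set B) (y : W) : Prop :=
  y ∈ par cs K ∧ ∀ w ∈ par cs K, cs.length w ≤ cs.length y

/-- The double coset `W_I · x · W_J` is core: `W_I·x = W_I·x·W_J = x·W_J`. -/
def IsCore (cs : CoxeterSystem M W) (I : Set B) (x : W) (J : Set B) : Prop :=
  lcos cs I x = dcos cs I x J ∧ dcos cs I x J = rcos cs x J

section helpers
open Classical in
/-- Generators of the signed reflection action. -/
noncomputable def act (cs : CoxeterSystem M W) (i : B) : Function.End (W × ZMod 2) :=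
  fun p => (cs.simple i * p.1 * cs.simple i, p.2 + if p.1 = cs.simple i then 1 else 0)

lemma rpow_conj (cs : CoxeterSystem M W) (i i' : B) (k : ℕ) :
    cs.simple i' * (cs.simple i * cs.simple i') ^ k =
      ((cs.simple i * cs.simple i') ^ k)⁻¹ * cs.simple i' := by
  induction k with
  | zero => simp
  | succ k ih =>
    rw [pow_succ, ← mul_assoc, ih, mul_inv_rev, mul_inv_rev]
    have e2 := (((Commute.refl (cs.simple i * cs.simple i')).pow_right k).inv_right.inv_left).eq
    simp only [mul_inv_rev, cs.inv_simple] at e2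
    simp only [cs.inv_simple]
    rw [e2]
    simp only [mul_assoc]

open Classical in
lemma act_pow (cs : CoxeterSystem M W) (i i' : B) (k : ℕ) (p : W × ZMod 2) :
    ((act cs i * act cs i') ^ k) p =
      ((cs.simple i * cs.simple i') ^ k * p.1 * ((cs.simple i * cs.simple i') ^ k)⁻¹,
        p.2 + ∑ j ∈ Finset.range (2 * k),
          if p.1 = cs.simple i' * (cs.simple i * cs.simple i') ^ j then (1 : ZMod 2) else 0) := by
  induction k with
  | zero => simp; rfl
  | succ k ih =>
    rw [pow_succ']
    change act cs i (act cs i' (((act cs i * act cs i') ^ k) p)) = _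
    rw [ih]
    have hr := rpow_conj cs i i' k
    generalize hR : (cs.simple i * cs.simple i') ^ k = R at *
    have h2 : (cs.simple i * cs.simple i') ^ (2 * k) = R * R := by
      rw [two_mul, pow_add, hR]
    have h3 : (cs.simple i * cs.simple i') ^ (2 * k + 1) = R * (cs.simple i * cs.simple i') * R := by
      rw [two_mul, add_assoc, pow_add, pow_succ', hR]; simp only [mul_assoc]
    have c1 : R * p.1 * R⁻¹ = cs.simple i' ↔ p.1 = cs.simple i' * (R * R) := by
      rw [← mul_assoc, hr, mul_inv_eq_iff_eq_mul, mul_assoc, eq_inv_mul_iff_mul_eq]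
    have c2 : cs.simple i' * (R * p.1 * R⁻¹) * cs.simple i' = cs.simple i ↔
        p.1 = cs.simple i' * (R * (cs.simple i * cs.simple i') * R) := by
      have : cs.simple i' * (R * (cs.simple i * cs.simple i') * R)
         = R⁻¹ * (cs.simple i' * cs.simple i * cs.simple i') * R := by
        rw [← mul_assoc, ← mul_assoc, hr]; simp only [mul_assoc]
      rw [this]
      constructor
      · intro h
        rw [← h]
        simp [mul_assoc]
      · intro h
        rw [h]
        simp [mul_assoc]
    rw [show 2 * (k + 1) = 2 * k + 1 + 1 by ring, Finset.sum_range_succ, Finset.sum_range_succ,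
      h2, h3]
    simp only [act, c1, c2, pow_succ', hR]
    refine Prod.ext ?_ ?_
    · simp [mul_assoc]
    · simp only [add_assoc]

lemma act_liftable (cs : CoxeterSystem M W) : M.IsLiftable (act cs) := by
  classical
  intro i i'
  funext p
  rw [act_pow, two_mul, Finset.sum_range_add]
  simp only [pow_add, cs.simple_mul_simple_pow, one_mul, inv_one, mul_one]
  rw [CharTwo.add_self_eq_zero, add_zero]
  rfl

/-- The signed reflection action. -/
noncomputable def Phi (cs : CoxeterSystem M W) : W →* Function.End (W × ZMod 2) :=
  cs.lift ⟨act cs, act_liftable cs⟩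

/-- The inversion cocycle. -/
noncomputable def nn (cs : CoxeterSystem M W) (w t : W) : ZMod 2 := (Phi cs w (t, 0)).2

open Classical in
lemma Phi_simple (cs : CoxeterSystem M W) (i : B) (p : W × ZMod 2) : Phi cs (cs.simple i) p =
    (cs.simple i * p.1 * cs.simple i, p.2 + if p.1 = cs.simple i then 1 else 0) := by
  rw [Phi, cs.lift_apply_simple]; rfl

lemma Phi_apply (cs : CoxeterSystem M W) (w : W) : ∀ (p : W × ZMod 2),
    Phi cs w p = (w * p.1 * w⁻¹, p.2 + nn cs w p.1) := by
  induction w using cs.simple_induction_left with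
  | one =>
    intro p
    rw [nn, map_one]
    refine Prod.ext ?_ ?_
    · change p.1 = 1 * p.1 * 1⁻¹
      simp
    · change p.2 = p.2 + 0
      simp
  | mul_simple_left w i ih =>
    intro p
    have h : ∀ q, Phi cs (cs.simple i * w) q = Phi cs (cs.simple i) (Phi cs w q) := by
      intro q; rw [map_mul]; rfl
    rw [nn, h, h, ih, ih, Phi_simple, Phi_simple]
    simp [mul_assoc, add_assoc]

lemma nn_mul (cs : CoxeterSystem M W) (u v t : W) :
    nn cs (u * v) t = nn cs v t + nn cs u (v * t * v⁻¹) := by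
  have h : Phi cs (u * v) (t, 0) = Phi cs u (Phi cs v (t, 0)) := by rw [map_mul]; rfl
  rw [nn, h, Phi_apply, Phi_apply]
  simp

lemma nn_one (cs : CoxeterSystem M W) (t : W) : nn cs 1 t = 0 := by
  simp [nn]; rfl

open Classical in
lemma nn_simple (cs : CoxeterSystem M W) (i : B) (t : W) :
    nn cs (cs.simple i) t = if t = cs.simple i then 1 else 0 := by
  rw [nn, Phi_simple]; simp

lemma nn_inv (cs : CoxeterSystem M W) (w t : W) : nn cs w⁻¹ t = nn cs w (w⁻¹ * t * w) := by
  have h := nn_mul cs w w⁻¹ t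
  rw [mul_inv_cancel, nn_one, inv_inv] at h
  exact (CharTwo.add_eq_zero.mp h.symm)

lemma nn_refl (cs : CoxeterSystem M W) {t : W} (ht : cs.IsReflection t) : nn cs t t = 1 := by
  obtain ⟨u, i, rfl⟩ := ht
  rw [nn_mul, nn_mul, nn_inv, nn_simple]
  simp [mul_assoc]
  rw [add_left_comm, CharTwo.add_self_eq_zero, add_zero]

lemma zne {a : ZMod 2} : a ≠ 0 ↔ a = 1 := by revert a; decide

/-- Word exchange. -/
lemma exch (cs : CoxeterSystem M W) (t : W) (K : Set B) (ω : List B) (hω : ∀ i ∈ ω, i ∈ K)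
    (h : nn cs (cs.wordProd ω) t ≠ 0) :
    ∃ ω' : List B, (∀ i ∈ ω', i ∈ K) ∧ ω'.length + 1 = ω.length ∧
      cs.wordProd ω' = cs.wordProd ω * t := by
  classical
  induction ω with
  | nil => simp [nn_one] at h
  | cons i ω ih =>
    simp only [List.mem_cons, forall_eq_or_imp] at hω
    by_cases h1 : nn cs (cs.wordProd ω) t ≠ 0
    · obtain ⟨ω', a, b, c⟩ := ih hω.2 h1
      refine ⟨i :: ω', ?_, by simp [b], by simp [cs.wordProd_cons, c, mul_assoc]⟩
      simpa using ⟨hω.1, a⟩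
    · push Not at h1
      rw [cs.wordProd_cons, nn_mul, h1, zero_add, nn_simple] at h
      have h2 : cs.wordProd ω * t * (cs.wordProd ω)⁻¹ = cs.simple i := by
        by_contra h3; simp [h3] at h
      refine ⟨ω, hω.2, by simp, ?_⟩
      rw [cs.wordProd_cons, ← h2]
      have := (show cs.IsReflection (cs.wordProd ω * t * (cs.wordProd ω)⁻¹) by
        rw [h2]; exact cs.isReflection_simple i)
      rw [cs.isReflection_conj_iff] at this
      simp [mul_assoc, this.mul_self]

lemma lt_of_nn (cs : CoxeterSystem M W) {w t : W} (h : nn cs w t ≠ 0) :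
    cs.length (w * t) < cs.length w := by
  obtain ⟨ω, hr, rfl⟩ := cs.exists_isReduced w
  obtain ⟨ω', -, a, b⟩ := exch cs t Set.univ ω (by simp) h
  rw [← b, hr.eq, ← a]
  exact Nat.lt_succ_of_le (cs.length_wordProd_le ω')

lemma nn_of_lt (cs : CoxeterSystem M W) {w t : W} (ht : cs.IsReflection t)
    (h : cs.length (w * t) < cs.length w) : nn cs w t = 1 := by
  by_contra h1
  rw [← zne] at h1
  push Not at h1
  have h2 : nn cs (w * t) t ≠ 0 := by
    rw [nn_mul, nn_refl cs ht]; simp [h1]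
  have := lt_of_nn cs h2
  rw [mul_assoc, ht.mul_self, mul_one] at this
  omega

lemma nn_eq_zero_of_le (cs : CoxeterSystem M W) {w t : W}
    (h : cs.length w ≤ cs.length (w * t)) : nn cs w t = 0 := by
  by_contra h1
  have := lt_of_nn cs h1
  omega

lemma len_succ_of_nn (cs : CoxeterSystem M W) {w : W} {i : B} (h : nn cs w (cs.simple i) = 0) :
    cs.length (w * cs.simple i) = cs.length w + 1 := by
  rcases cs.length_mul_simple w i with h1 | h1
  · exact h1
  · have := nn_of_lt cs (cs.isReflection_simple i) (w := w) (by omega)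
    rw [h] at this; simp at this

lemma word_mem (cs : CoxeterSystem M W) {K : Set B} {ω : List B} (h : ∀ i ∈ ω, i ∈ K) :
    cs.wordProd ω ∈ par cs K := by
  induction ω with
  | nil => simp [one_mem]
  | cons i ω ih =>
    rw [cs.wordProd_cons]
    simp only [List.mem_cons, forall_eq_or_imp] at h
    exact mul_mem (Subgroup.subset_closure ⟨i, h.1, rfl⟩) (ih h.2)

lemma simple_mem (cs : CoxeterSystem M W) {K : Set B} {i : B} (h : i ∈ K) :
    cs.simple i ∈ par cs K := Subgroup.subset_closure ⟨i, h, rfl⟩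

lemma red_word (cs : CoxeterSystem M W) {K : Set B} {w : W} (hw : w ∈ par cs K) :
    ∃ ω : List B, (∀ i ∈ ω, i ∈ K) ∧ ω.length = cs.length w ∧ cs.wordProd ω = w := by
  have step : ∀ w : W, ∀ i ∈ K, (∃ ω : List B, (∀ i ∈ ω, i ∈ K) ∧ ω.length = cs.length w ∧
      cs.wordProd ω = w) → ∃ ω : List B, (∀ i ∈ ω, i ∈ K) ∧
      ω.length = cs.length (w * cs.simple i) ∧ cs.wordProd ω = w * cs.simple i := by
    rintro w i hi ⟨ω, a, b, rfl⟩
    by_cases h : nn cs (cs.wordProd ω) (cs.simple i) = 0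
    · refine ⟨ω ++ [i], ?_, ?_, by simp [cs.wordProd_append]⟩
      · intro j hj
        simp only [List.mem_append, List.mem_singleton] at hj
        rcases hj with hj | rfl
        · exact a j hj
        · exact hi
      · rw [len_succ_of_nn cs h]; simp [b]
    · obtain ⟨ω', a', b', c'⟩ := exch cs _ K ω a h
      refine ⟨ω', a', ?_, c'⟩
      have := lt_of_nn cs h
      rcases cs.length_mul_simple (cs.wordProd ω) i with h1 | h1 <;> omega
  unfold par at hw
  induction hw using Subgroup.closure_induction_right with
  | one => exact ⟨[], by simp, by simp, by simp⟩
  | mul_right x hx y hy ih =>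
    obtain ⟨i, hi, rfl⟩ := hy
    exact step x i hi ih
  | mul_inv_cancel x hx y hy ih =>
    obtain ⟨i, hi, rfl⟩ := hy
    rw [cs.inv_simple]
    exact step x i hi ih

/-- A length-one element of a parabolic is one of its simple reflections. -/
lemma simple_of_len_one (cs : CoxeterSystem M W) {K : Set B} {w : W} (hw : w ∈ par cs K)
    (h : cs.length w = 1) : ∃ i ∈ K, w = cs.simple i := by
  obtain ⟨ω, a, b, rfl⟩ := red_word cs hw
  rw [h, List.length_eq_one_iff] at b
  obtain ⟨i, rfl⟩ := b
  exact ⟨i, a i (by simp), by simp⟩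

/-- Peeling off a right descent in the parabolic. -/
lemma peel (cs : CoxeterSystem M W) {K : Set B} {w : W} (hw : w ∈ par cs K) (h : w ≠ 1) :
    ∃ i ∈ K, ∃ v ∈ par cs K, w = v * cs.simple i ∧ cs.length w = cs.length v + 1 := by
  obtain ⟨ω, a, b, rfl⟩ := red_word cs hw
  rcases List.eq_nil_or_concat ω with rfl | ⟨ω', i, rfl⟩
  · simp at h
  · have a' : ∀ j ∈ ω', j ∈ K := fun j hj => a j (by simp [hj])
    refine ⟨i, a i (by simp), cs.wordProd ω', word_mem cs a', ?_, ?_⟩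
    · simp [cs.wordProd_append]
    · have h1 := cs.length_wordProd_le ω'
      have h2 := cs.length_mul_simple (cs.wordProd ω') i
      simp only [List.concat_eq_append, cs.wordProd_append, cs.wordProd_singleton,
        List.length_append, List.length_singleton] at b ⊢
      omega

lemma nn_mem (cs : CoxeterSystem M W) {K : Set B} {w t : W} (hw : w ∈ par cs K)
    (h : nn cs w t ≠ 0) : t ∈ par cs K := by
  obtain ⟨ω, a, b, rfl⟩ := red_word cs hw
  obtain ⟨ω', a', b', c'⟩ := exch cs _ K ω a h
  have := word_mem cs a'
  rw [c'] at this
  exact (Subgroup.mul_mem_cancel_left _ hw).mp this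

lemma add_right (cs : CoxeterSystem M W) {J : Set B} {x : W}
    (hx : ∀ b ∈ par cs J, cs.length x ≤ cs.length (x * b)) :
    ∀ n : ℕ, ∀ b ∈ par cs J, cs.length b = n → cs.length (x * b) = cs.length x + cs.length b := by
  intro n
  induction n with
  | zero =>
    intro b _ h
    rw [cs.length_eq_zero_iff] at h
    simp [h]
  | succ n ih =>
    intro b hb h
    have hne : b ≠ 1 := by rintro rfl; simp at h
    obtain ⟨i, hi, v, hv, rfl, hl⟩ := peel cs hb hne
    have h1 := ih v hv (by omega)
    have h2 : nn cs (x * v) (cs.simple i) = 0 := by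
      rw [nn_mul, nn_eq_zero_of_le cs (by omega), nn_eq_zero_of_le cs, add_zero]
      exact hx _ (mul_mem (mul_mem hv (simple_mem cs hi)) (inv_mem hv))
    rw [← mul_assoc, len_succ_of_nn cs h2, h1, hl]; ring

lemma add_left (cs : CoxeterSystem M W) {I : Set B} {x : W}
    (hx : ∀ a ∈ par cs I, cs.length x ≤ cs.length (a * x)) (a : W) (ha : a ∈ par cs I) :
    cs.length (a * x) = cs.length a + cs.length x := by
  have h := add_right cs (J := I) (x := x⁻¹) (fun b hb => by
    rw [← cs.length_inv (x⁻¹ * b)]; simpa using hx b⁻¹ (inv_mem hb)) _ a⁻¹ (inv_mem ha) rfl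
  rw [← cs.length_inv (x⁻¹ * a⁻¹)] at h
  simp only [mul_inv_rev, inv_inv, cs.length_inv] at h
  omega

/-- Kilmoyer's theorem. -/
lemma kilmoyer (cs : CoxeterSystem M W) {I J : Set B} {x : W}
    (hl : ∀ a ∈ par cs I, cs.length x ≤ cs.length (a * x))
    (hr : ∀ b ∈ par cs J, cs.length x ≤ cs.length (x * b)) :
    ∀ n : ℕ, ∀ b ∈ par cs J, cs.length b = n → x * b * x⁻¹ ∈ par cs I →
      x * b * x⁻¹ ∈ par cs {i ∈ I | ∃ j ∈ J, cs.simple i = x * cs.simple j * x⁻¹} := by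
  intro n
  induction n with
  | zero =>
    intro b _ h _
    rw [cs.length_eq_zero_iff] at h
    simp [h, one_mem]
  | succ n ih =>
    intro b hb h ha
    have hne : b ≠ 1 := by rintro rfl; simp at h
    obtain ⟨j, hj, v, hv, hbv, hlen⟩ := peel cs hb hne
    have ht := cs.isReflection_simple j
    have e1 : nn cs (x * b) (cs.simple j) = 1 := by
      rw [nn_mul, nn_of_lt cs ht (by rw [hlen, hbv]; simp), nn_eq_zero_of_le cs, add_zero]
      exact hr _ (mul_mem (mul_mem hb (simple_mem cs hj)) (inv_mem hb))
    have e2 : nn cs (x * b * x⁻¹) (x * cs.simple j * x⁻¹) ≠ 0 := by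
      have := nn_mul cs (x * b * x⁻¹) x (cs.simple j)
      rw [inv_mul_cancel_right, e1, nn_eq_zero_of_le cs (hr _ (simple_mem cs hj)), zero_add] at this
      rw [← this]; simp
    have hm := nn_mem cs ha e2
    have e3 := add_left cs hl _ hm
    rw [inv_mul_cancel_right, add_right cs hr _ _ (simple_mem cs hj) rfl, cs.length_simple] at e3
    obtain ⟨i, hi, hij⟩ := simple_of_len_one cs hm (by omega)
    have e4 : x * b * x⁻¹ = (x * v * x⁻¹) * (x * cs.simple j * x⁻¹) := by
      rw [hbv]; group
    rw [e4] at ha ⊢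
    refine mul_mem (ih v hv (by omega) ((Subgroup.mul_mem_cancel_right _ hm).mp ha)) ?_
    rw [hij]
    exact simple_mem cs ⟨hi, j, hj, hij.symm⟩

lemma kilmoyer_set (cs : CoxeterSystem M W) {I J : Set B} {x : W}
    (hl : ∀ a ∈ par cs I, cs.length x ≤ cs.length (a * x))
    (hr : ∀ b ∈ par cs J, cs.length x ≤ cs.length (x * b)) (w : W) :
    (w ∈ par cs I ∧ ∃ b ∈ par cs J, w = x * b * x⁻¹) ↔
      w ∈ par cs {i ∈ I | ∃ j ∈ J, cs.simple i = x * cs.simple j * x⁻¹} := by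
  constructor
  · rintro ⟨h, b, hb, rfl⟩
    exact kilmoyer cs hl hr _ b hb rfl h
  · intro h
    refine ⟨Subgroup.closure_mono (Set.image_mono fun i hi => hi.1) h, x⁻¹ * w * x, ?_, by group⟩
    unfold par at h
    have : Subgroup.closure (cs.simple '' {i ∈ I | ∃ j ∈ J, cs.simple i = x * cs.simple j * x⁻¹}) ≤
        (par cs J).comap (MulAut.conj x⁻¹).toMonoidHom := by
      rw [Subgroup.closure_le]
      rintro _ ⟨i, ⟨hi, j, hj, e⟩, rfl⟩
      simp only [SetLike.mem_coe, Subgroup.mem_comap, e]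
      simpa [mul_assoc] using simple_mem cs hj
    simpa using this h

/-- Conjugate standard parabolics have the same rank. -/
lemma conj_rank (cs : CoxeterSystem M W) {K L : Set B} (g : W)
    (h : ∀ w, w ∈ par cs L ↔ g * w * g⁻¹ ∈ par cs K) :
    (cs.simple '' L).ncard = (cs.simple '' K).ncard := by
  obtain ⟨b, hb, hmin⟩ : ∃ b ∈ par cs L, ∀ c ∈ par cs L,
      cs.length (g * b) ≤ cs.length (g * c) := by
    have := WellFounded.has_min (InvImage.wf (fun b => cs.length (g * b)) Nat.lt_wfRel.wf)
      (par cs L : Set W) ⟨1, one_mem _⟩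
    obtain ⟨b, hb, h⟩ := this
    exact ⟨b, hb, fun c hc => not_lt.mp (h c hc)⟩
  set x := g * b with hx
  have hK : ∀ w, w ∈ par cs L ↔ x * w * x⁻¹ ∈ par cs K := by
    intro w
    rw [show x * w * x⁻¹ = g * (b * w * b⁻¹) * g⁻¹ by rw [hx]; group, ← h]
    rw [Subgroup.mul_mem_cancel_right _ (inv_mem hb), Subgroup.mul_mem_cancel_left _ hb]
  have hr : ∀ c ∈ par cs L, cs.length x ≤ cs.length (x * c) := by
    intro c hc
    rw [hx, mul_assoc]
    exact hmin _ (mul_mem hb hc)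
  have hl : ∀ a ∈ par cs K, cs.length x ≤ cs.length (a * x) := by
    intro a ha
    have := hr (x⁻¹ * a * x) ((hK _).mpr (by simpa [mul_assoc] using ha))
    simpa [mul_assoc] using this
  have himg : (fun v => x * v * x⁻¹) '' (cs.simple '' L) = cs.simple '' K := by
    ext w
    constructor
    · rintro ⟨_, ⟨i, hi, rfl⟩, rfl⟩
      have hm := (hK _).mp (simple_mem cs hi)
      have e := add_left cs hl _ hm
      rw [inv_mul_cancel_right, add_right cs hr _ _ (simple_mem cs hi) rfl, cs.length_simple] at e
      obtain ⟨k, hk, e'⟩ := simple_of_len_one cs hm (by omega)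
      exact ⟨k, hk, e'.symm⟩
    · rintro ⟨k, hk, rfl⟩
      have hm : x⁻¹ * cs.simple k * x ∈ par cs L :=
        (hK _).mpr (by simpa [mul_assoc] using simple_mem cs hk)
      have e := add_right cs hr _ _ hm rfl
      rw [show x * (x⁻¹ * cs.simple k * x) = cs.simple k * x by group,
        add_left cs hl _ (simple_mem cs hk), cs.length_simple] at e
      obtain ⟨i, hi, e'⟩ := simple_of_len_one cs hm (by omega)
      exact ⟨_, ⟨i, hi, rfl⟩, by simp only [← e']; group⟩
  have hinj : Function.Injective (fun v => x * v * x⁻¹) := by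
    intro a b hab
    simpa using hab
  rw [← himg, Set.ncard_image_of_injective _ hinj]

lemma long_len (cs : CoxeterSystem M W) (wS : W) (hwS : ∀ w : W, cs.length w ≤ cs.length wS) :
    ∀ n : ℕ, ∀ x : W, cs.length x = n → cs.length (wS * x) + cs.length x = cs.length wS := by
  intro n
  induction n with
  | zero =>
    intro x h
    rw [cs.length_eq_zero_iff] at h
    simp [h]
  | succ n ih =>
    intro x h
    have hne : x ≠ 1 := by rintro rfl; simp at h
    obtain ⟨i, hi⟩ := cs.exists_rightDescent_of_ne_one hne
    rw [cs.isRightDescent_iff] at hi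
    have h1 := ih (x * cs.simple i) (by omega)
    have hR : cs.IsReflection (x * cs.simple i * x⁻¹) := ⟨x, i, rfl⟩
    have h2 : nn cs wS (x * cs.simple i * x⁻¹) = 1 := by
      apply nn_of_lt cs hR
      exact lt_of_le_of_ne (hwS _) (hR.length_mul_left_ne wS)
    have h3 : nn cs (wS * x) (cs.simple i) = 0 := by
      rw [nn_mul, h2, nn_of_lt cs (cs.isReflection_simple i) (by omega)]; rfl
    have h4 := len_succ_of_nn cs h3
    rw [mul_assoc] at h4
    omega

end helpers

theorem statement_16 (cs : CoxeterSystem M W) [Finite W] (wS : W)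
    (hwS : ∀ w : W, cs.length w ≤ cs.length wS)
    (I J : Set B) (pm : W)
    (hpmem : pm ∈ dcos cs I wS J) (hpmin : IsMinRep cs I pm J) :
    (∃ g ∈ par cs I,
      (fun w => g * w * g⁻¹) ''
          {w : W | w ∈ par cs I ∧ ∃ b ∈ par cs J, w = pm * b * pm⁻¹} =
        (par cs {i ∈ I | ∃ j ∈ J, cs.simple i = wS * cs.simple j * wS} : Set W)) ∧
    ((cs.simple '' I) ∩ ((fun v => pm * v * pm⁻¹) '' (cs.simple '' J))).ncard =
      ((cs.simple '' I) ∩ ((fun v => wS * v * wS) '' (cs.simple '' J))).ncard := by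
  obtain ⟨a, ha, b, hb, hpm⟩ := hpmem
  have h2 : wS * wS = 1 := by
    have := long_len cs wS hwS _ wS rfl
    rw [← cs.length_eq_zero_iff]; omega
  have hinv : wS⁻¹ = wS := inv_eq_of_mul_eq_one_left h2
  have hc : ∀ j, ∃ i, wS * cs.simple j * wS = cs.simple i := by
    intro j
    rw [← cs.length_eq_one_iff]
    have e1 := long_len cs wS hwS _ (cs.simple j * wS) rfl
    have e2 := long_len cs wS hwS _ (cs.simple j) rfl
    have e3 : cs.length (cs.simple j * wS) = cs.length (wS * cs.simple j) := by
      rw [← cs.length_inv, mul_inv_rev, hinv, cs.inv_simple]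
    rw [cs.length_simple] at e2
    rw [mul_assoc]
    omega
  -- the twisted set `w_S J w_S`
  set J' : Set B := {k | ∃ j ∈ J, cs.simple k = wS * cs.simple j * wS} with hJ'
  have himg : cs.simple '' J' = (MulAut.conj wS).toMonoidHom '' (cs.simple '' J) := by
    ext w
    constructor
    · rintro ⟨k, ⟨j, hj, e⟩, rfl⟩
      exact ⟨_, ⟨j, hj, rfl⟩, by simp [e, hinv]⟩
    · rintro ⟨_, ⟨j, hj, rfl⟩, rfl⟩
      obtain ⟨i, hi⟩ := hc j
      exact ⟨i, ⟨j, hj, hi.symm⟩, by simp [← hi, hinv]⟩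
  have hpar : par cs J' = (par cs J).map (MulAut.conj wS).toMonoidHom := by
    rw [par, himg, par, MonoidHom.map_closure]
  have hKeq : {i ∈ I | ∃ j ∈ J', cs.simple i = 1 * cs.simple j * 1⁻¹} =
      {i ∈ I | ∃ j ∈ J, cs.simple i = wS * cs.simple j * wS} := by
    ext i
    constructor
    · rintro ⟨hi, k, ⟨j, hj, e⟩, e'⟩
      exact ⟨hi, j, hj, by rw [e', e]; simp⟩
    · rintro ⟨hi, j, hj, e⟩
      exact ⟨hi, i, ⟨j, hj, e⟩, by simp⟩
  have hK : ∀ w, (w ∈ par cs I ∧ ∃ c ∈ par cs J, w = wS * c * wS) ↔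
      w ∈ par cs {i ∈ I | ∃ j ∈ J, cs.simple i = wS * cs.simple j * wS} := by
    intro w
    rw [← hKeq, ← kilmoyer_set cs (by simp) (by simp), hpar]
    simp [Subgroup.mem_map, hinv, eq_comm]
  have key : ∀ w, (w ∈ par cs I ∧ ∃ c ∈ par cs J, w = pm * c * pm⁻¹) ↔
      a⁻¹ * w * a ∈ par cs {i ∈ I | ∃ j ∈ J, cs.simple i = wS * cs.simple j * wS} := by
    intro w
    rw [← hK, Subgroup.mul_mem_cancel_right _ ha, Subgroup.mul_mem_cancel_left _ (inv_mem ha)]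
    refine and_congr_right fun _ => ?_
    constructor
    · rintro ⟨c, hcm, rfl⟩
      refine ⟨b * c * b⁻¹, mul_mem (mul_mem hb hcm) (inv_mem hb), ?_⟩
      rw [hpm]
      simp [mul_assoc, hinv]
    · rintro ⟨c, hcm, e⟩
      refine ⟨b⁻¹ * c * b, mul_mem (mul_mem (inv_mem hb) hcm) hb, ?_⟩
      rw [hpm, show w = a * (a⁻¹ * w * a) * a⁻¹ by group, e]
      simp [mul_assoc, hinv]
  refine ⟨⟨a⁻¹, inv_mem ha, ?_⟩, ?_⟩
  · ext w
    simp only [inv_inv, Set.mem_image, Set.mem_ofPred_eq, SetLike.mem_coe]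
    constructor
    · rintro ⟨v, hv, rfl⟩
      exact (key v).mp hv
    · intro hw
      exact ⟨a * w * a⁻¹, (key _).mpr (by simpa [mul_assoc] using hw), by group⟩
  · have hl : ∀ c ∈ par cs I, cs.length pm ≤ cs.length (c * pm) := fun c hc =>
      hpmin _ ⟨c, hc, 1, one_mem _, by simp⟩
    have hr : ∀ c ∈ par cs J, cs.length pm ≤ cs.length (pm * c) := fun c hc =>
      hpmin _ ⟨1, one_mem _, c, hc, by simp⟩
    have hset : ∀ f : W → W, cs.simple '' I ∩ (f '' (cs.simple '' J)) =
        cs.simple '' {i ∈ I | ∃ j ∈ J, cs.simple i = f (cs.simple j)} := by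
      intro f
      ext w
      constructor
      · rintro ⟨⟨i, hi, rfl⟩, _, ⟨j, hj, rfl⟩, e⟩
        exact ⟨i, ⟨hi, j, hj, e.symm⟩, rfl⟩
      · rintro ⟨i, ⟨hi, j, hj, e⟩, rfl⟩
        exact ⟨⟨i, hi, rfl⟩, _, ⟨j, hj, rfl⟩, e.symm⟩
    rw [hset, hset]
    refine conj_rank cs a⁻¹ fun w => ?_
    rw [← kilmoyer_set cs hl hr, key, inv_inv]


end CoxeterAtoms
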